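/- Let R be a ring without unity admitting a finite cover by proper subrings, and suppose R is finite of prime characteristic p with pR = 0. Define R' = 𝔽_p × R with coordinatewise addition and multiplication (n₁,r₁)(n₂,r₂) = (n₁n₂, n₁r₂ + n₂r₁ + r₁r₂). Then R' is a unital ring with identity (1,0), and the minimal size of a cover of R by proper subrings equals the minimal size of a cover of R' by proper unital subrings (subrings containing (1,0)). -/

import Mathlib

section UnitizationSubring

variable {R : Type*} [NonUnitalRing R] {p : ℕ} [Module (ZMod p) R]

theorem NonUnitalSubring.zmod_smul_mem (S : NonUnitalSubring R) (n : ZMod p) {r : R}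
    (hr : r ∈ S) : n • r ∈ S := by
  obtain ⟨k, rfl⟩ := ZMod.intCast_surjective n
  rw [Int.cast_smul_eq_zsmul]
  exact zsmul_mem hr k

theorem Subring.inl_mem_unitization_zmod (T : Subring (Unitization (ZMod p) R)) (n : ZMod p) :
    Unitization.inl n ∈ T := by
  obtain ⟨k, rfl⟩ := ZMod.intCast_surjective n
  rw [← Unitization.inlRingHom_apply, map_intCast]
  exact intCast_mem T k

theorem Subring.inr_snd_mem_unitization_zmod (T : Subring (Unitization (ZMod p) R))
    {x : Unitization (ZMod p) R} :
    (x.snd : Unitization (ZMod p) R) ∈ T ↔ x ∈ T := by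
  conv_rhs => rw [← Unitization.inl_fst_add_inr_snd_eq x]
  exact (add_mem_cancel_left (T.inl_mem_unitization_zmod x.fst)).symm

/-- The subring of `Unitization (ZMod p) R` of elements whose second component lies in `S`. -/
def NonUnitalSubring.unitizationZMod (S : NonUnitalSubring R) :
    Subring (Unitization (ZMod p) R) where
  carrier := {x | x.snd ∈ S}
  mul_mem' {a b} ha hb := by
    simp only [Set.mem_ofPred_eq, Unitization.snd_mul] at *
    exact add_mem (add_mem (S.zmod_smul_mem _ hb) (S.zmod_smul_mem _ ha)) (mul_mem ha hb)
  one_mem' := by simp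
  add_mem' ha hb := add_mem (S := NonUnitalSubring R) ha hb
  zero_mem' := by simp
  neg_mem' ha := neg_mem (S := NonUnitalSubring R) ha

variable (R p) in
/-- Subrings of `R` correspond to unital subrings of `Unitization (ZMod p) R`. -/
def NonUnitalSubring.orderIsoUnitizationZMod :
    NonUnitalSubring R ≃o Subring (Unitization (ZMod p) R) where
  toFun S := S.unitizationZMod
  invFun T := T.toNonUnitalSubring.comap (Unitization.inrNonUnitalAlgHom (ZMod p) R)
  left_inv _ := rfl
  right_inv T := by
    ext x
    exact T.inr_snd_mem_unitization_zmod
  map_rel_iff' {S T} :=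
    ⟨fun h r hr => h (show (r : Unitization (ZMod p) R) ∈ S.unitizationZMod from hr),
      fun h _ hx => h hx⟩

theorem NonUnitalSubring.mem_orderIsoUnitizationZMod {S : NonUnitalSubring R}
    {x : Unitization (ZMod p) R} : x ∈ orderIsoUnitizationZMod R p S ↔ x.snd ∈ S :=
  Iff.rfl

variable (R p) in
theorem NonUnitalSubring.cover_card_iff_unitization_zmod (n : ℕ) :
    (∃ C : Finset (NonUnitalSubring R), C.card = n ∧
        (∀ S ∈ C, S ≠ ⊤) ∧ ∀ x : R, ∃ S ∈ C, x ∈ S) ↔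
      ∃ C : Finset (Subring (Unitization (ZMod p) R)), C.card = n ∧
        (∀ S ∈ C, S ≠ ⊤) ∧ ∀ x : Unitization (ZMod p) R, ∃ S ∈ C, x ∈ S := by
  rw [← (orderIsoUnitizationZMod R p).toEquiv.finsetCongr.exists_congr_right]
  refine exists_congr fun C => ?_
  simp only [Equiv.finsetCongr_apply, Finset.card_map, Finset.mem_map, forall_exists_index,
    and_imp, forall_apply_eq_imp_iff₂, exists_exists_and_eq_and, Equiv.coe_toEmbedding,
    RelIso.coe_fn_toEquiv, ne_eq, map_eq_top_iff, mem_orderIsoUnitizationZMod]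
  exact and_congr_right' (and_congr_right' ⟨fun h x => h x.snd, fun h r => h r⟩)

end UnitizationSubring

/-- Let `R` be a finite ring without unity, of prime characteristic `p` (so `pR = 0`,
encoded by the `ZMod p`-module structure), admitting a finite cover by proper subrings.
Let `R' = 𝔽_p × R` with multiplication `(n₁,r₁)(n₂,r₂) = (n₁n₂, n₁r₂ + n₂r₁ + r₁r₂)`
(the unitization `Unitization (ZMod p) R`).  Then `R'` is unital with identity `(1,0)`,
and the minimal size of a cover of `R` by proper subrings equals the minimal size of a
cover of `R'` by proper unital subrings. -/
theorem stmt_14 {R : Type*} [NonUnitalRing R] [Fintype R] (p : ℕ) (hp : p.Prime)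
    [Module (ZMod p) R] [SMulCommClass (ZMod p) R R] [IsScalarTower (ZMod p) R R]
    (hnounit : ¬ ∃ e : R, ∀ r : R, e * r = r ∧ r * e = r)
    (hcov : ∃ C : Finset (NonUnitalSubring R),
      (∀ S ∈ C, S ≠ ⊤) ∧ ∀ x : R, ∃ S ∈ C, x ∈ S) :
    (∀ a b : Unitization (ZMod p) R,
        (a * b).fst = a.fst * b.fst ∧
        (a * b).snd = a.fst • b.snd + b.fst • a.snd + a.snd * b.snd) ∧
    ((1 : Unitization (ZMod p) R).fst = 1 ∧ (1 : Unitization (ZMod p) R).snd = 0) ∧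
    {n : ℕ | ∃ C : Finset (Subring (Unitization (ZMod p) R)), C.card = n ∧
      (∀ S ∈ C, S ≠ ⊤) ∧ ∀ x : Unitization (ZMod p) R, ∃ S ∈ C, x ∈ S}.Nonempty ∧
    sInf {n : ℕ | ∃ C : Finset (NonUnitalSubring R), C.card = n ∧
        (∀ S ∈ C, S ≠ ⊤) ∧ ∀ x : R, ∃ S ∈ C, x ∈ S} =
      sInf {n : ℕ | ∃ C : Finset (Subring (Unitization (ZMod p) R)), C.card = n ∧
        (∀ S ∈ C, S ≠ ⊤) ∧ ∀ x : Unitization (ZMod p) R, ∃ S ∈ C, x ∈ S} := by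
  simp only [NonUnitalSubring.cover_card_iff_unitization_zmod R p, and_true]
  refine ⟨fun a b => ⟨Unitization.fst_mul a b, Unitization.snd_mul a b⟩,
    ⟨Unitization.fst_one, Unitization.snd_one⟩, ?_⟩
  obtain ⟨C, hC⟩ := hcov
  exact ⟨C.card, (NonUnitalSubring.cover_card_iff_unitization_zmod R p _).1 ⟨C, rfl, hC⟩⟩
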